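/- arXiv:1904.09224 — 3 statements merged into one kernel-verified Lean document; each statement's English description precedes it below -/
import Mathlib

section
/- In K one has E_X * E_Y − E_Y * E_X = 2(Y−X) · (G * H), where E_X(x,y) = 1/(1−xX), E_Y(x,y) = 1/(1−xY), G(x,y) = 1/((1−xX)(1−xY)), and H(x,y) = (y−x)/((1−xX)(1−xY)). -/
/-!
`K` is the field of rational functions over ℚ in the six variables
`x₁, x₂, y₁, y₂, X, Y`, realized as the fraction field of
`MvPolynomial (Fin 6) ℚ`.  `starMul` is the Kontsevich–Soibelman shuffle
product of the Cohomological Hall algebra of the Kronecker quiver in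
bidegree `(1,1) × (1,1)`, and `starMul'` the one in bidegree `(1,0) × (1,2)`
(evaluated on classes not depending on the `y`-variables of the second factor).
-/

open MvPolynomial

noncomputable section

abbrev P6 : Type := MvPolynomial (Fin 6) ℚ
abbrev K : Type := FractionRing P6

def x1 : K := algebraMap P6 K (X 0)
def x2 : K := algebraMap P6 K (X 1)
def y1 : K := algebraMap P6 K (X 2)
def y2 : K := algebraMap P6 K (X 3)
def Xv : K := algebraMap P6 K (X 4)
def Yv : K := algebraMap P6 K (X 5)

/-- The shuffle product in bidegree `(1,1) × (1,1)`:
`f*g = (1/((x₂−x₁)(y₂−y₁))) · ( f(x₁,y₁)g(x₂,y₂)(y₂−x₁)² − f(x₁,y₂)g(x₂,y₁)(y₁−x₁)²`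
`− f(x₂,y₁)g(x₁,y₂)(y₂−x₂)² + f(x₂,y₂)g(x₁,y₁)(y₁−x₂)² )`. -/
def starMul (f g : K → K → K) : K :=
  ((x2 - x1) * (y2 - y1))⁻¹ *
    (f x1 y1 * g x2 y2 * (y2 - x1) ^ 2 - f x1 y2 * g x2 y1 * (y1 - x1) ^ 2 -
      f x2 y1 * g x1 y2 * (y2 - x2) ^ 2 + f x2 y2 * g x1 y1 * (y1 - x2) ^ 2)

/-- The shuffle product in bidegree `(1,0) × (1,2)`:
`f∗'g = (1/(x₂−x₁)) · ( f(x₁)g(x₂)(y₁−x₁)²(y₂−x₁)² − f(x₂)g(x₁)(y₁−x₂)²(y₂−x₂)² )`. -/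
def starMul' (f g : K → K) : K :=
  (x2 - x1)⁻¹ *
    (f x1 * g x2 * (y1 - x1) ^ 2 * (y2 - x1) ^ 2 -
      f x2 * g x1 * (y1 - x2) ^ 2 * (y2 - x2) ^ 2)

/-- `E(X)(x,y) = 1/(1−xX)`. -/
def EX : K → K → K := fun x _ => (1 - x * Xv)⁻¹
/-- `E(Y)(x,y) = 1/(1−xY)`. -/
def EY : K → K → K := fun x _ => (1 - x * Yv)⁻¹
/-- `F(X)(x,y) = (y−x)/(1−xX)`. -/
def FX : K → K → K := fun x y => (y - x) / (1 - x * Xv)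
/-- `F(Y)(x,y) = (y−x)/(1−xY)`. -/
def FY : K → K → K := fun x y => (y - x) / (1 - x * Yv)
/-- `G(x,y) = (YE(Y)−XE(X))/(Y−X) = 1/((1−xX)(1−xY))`. -/
def G : K → K → K := fun x _ => ((1 - x * Xv) * (1 - x * Yv))⁻¹
/-- `H(x,y) = (YF(Y)−XF(X))/(Y−X) = (y−x)/((1−xX)(1−xY))`. -/
def H : K → K → K := fun x y => (y - x) / ((1 - x * Xv) * (1 - x * Yv))
/-- `g₀(x) = 1/((1−xX)(1−xY))`. -/
def g0 : K → K := fun x => ((1 - x * Xv) * (1 - x * Yv))⁻¹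

/-- `1 - x_i T` is nonzero in `K`, as its constant term is `1`. -/
lemma one_sub_ne (i j : Fin 6) :
    (1 : K) - algebraMap P6 K (X i) * algebraMap P6 K (X j) ≠ 0 := by
  intro h
  have h' : algebraMap P6 K (1 - X i * X j) = algebraMap P6 K 0 := by
    rw [map_sub, map_mul, map_one, map_zero]; exact h
  have h2 := IsFractionRing.injective P6 K h'
  have h3 := congrArg (MvPolynomial.eval (fun _ => (0 : ℚ))) h2
  simp at h3

/-- The identity over an arbitrary field. -/
lemma field_identity {k : Type*} [Field k] (d u v p q S T : k)
    (h1 : 1 - u * S ≠ 0) (h2 : 1 - v * S ≠ 0) (h3 : 1 - u * T ≠ 0) (h4 : 1 - v * T ≠ 0) :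
    d * ((1 - u * S)⁻¹ * (1 - v * T)⁻¹ * (q - u) ^ 2 - (1 - u * S)⁻¹ * (1 - v * T)⁻¹ * (p - u) ^ 2 -
        (1 - v * S)⁻¹ * (1 - u * T)⁻¹ * (q - v) ^ 2 + (1 - v * S)⁻¹ * (1 - u * T)⁻¹ * (p - v) ^ 2) -
      d * ((1 - u * T)⁻¹ * (1 - v * S)⁻¹ * (q - u) ^ 2 - (1 - u * T)⁻¹ * (1 - v * S)⁻¹ * (p - u) ^ 2 -
        (1 - v * T)⁻¹ * (1 - u * S)⁻¹ * (q - v) ^ 2 + (1 - v * T)⁻¹ * (1 - u * S)⁻¹ * (p - v) ^ 2) =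
    2 * (T - S) * (d *
      (((1 - u * S) * (1 - u * T))⁻¹ * ((q - v) / ((1 - v * S) * (1 - v * T))) * (q - u) ^ 2 -
        ((1 - u * S) * (1 - u * T))⁻¹ * ((p - v) / ((1 - v * S) * (1 - v * T))) * (p - u) ^ 2 -
        ((1 - v * S) * (1 - v * T))⁻¹ * ((q - u) / ((1 - u * S) * (1 - u * T))) * (q - v) ^ 2 +
        ((1 - v * S) * (1 - v * T))⁻¹ * ((p - u) / ((1 - u * S) * (1 - u * T))) * (p - v) ^ 2)) := by
  have h2' : 1 - S * v ≠ 0 := by rwa [mul_comm]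
  have h1' : 1 - S * u ≠ 0 := by rwa [mul_comm]
  have h3' : 1 - T * u ≠ 0 := by rwa [mul_comm]
  have h4' : 1 - T * v ≠ 0 := by rwa [mul_comm]
  field_simp
  ring

/-- `[E(X),E(Y)]_* = 2(Y−X)·(G * H)`. -/
theorem stmt7 : starMul EX EY - starMul EY EX = 2 * (Yv - Xv) * starMul G H := by
  exact field_identity ((x2 - x1) * (y2 - y1))⁻¹ x1 x2 y1 y2 Xv Yv
    (one_sub_ne 0 4) (one_sub_ne 1 4) (one_sub_ne 0 5) (one_sub_ne 1 5)

end
end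

section
/- In K one has G * H = (y_1+y_2−x_1−x_2) / ((1−x_1X)(1−x_2X)(1−x_1Y)(1−x_2Y)), where G(x,y) = 1/((1−xX)(1−xY)) and H(x,y) = (y−x)/((1−xX)(1−xY)). -/
/-!
`K` is the field of rational functions over ℚ in the six variables
`x₁, x₂, y₁, y₂, X, Y`, realized as the fraction field of
`MvPolynomial (Fin 6) ℚ`.  `starMul` is the Kontsevich–Soibelman shuffle
product of the Cohomological Hall algebra of the Kronecker quiver in
bidegree `(1,1) × (1,1)`, and `starMul'` the one in bidegree `(1,0) × (1,2)`
(evaluated on classes not depending on the `y`-variables of the second factor).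
-/

open MvPolynomial

noncomputable section

/-- `G * H = (y₁+y₂−x₁−x₂)/((1−x₁X)(1−x₂X)(1−x₁Y)(1−x₂Y))`. -/
theorem stmt9 : starMul G H
    = (y1 + y2 - x1 - x2) /
        ((1 - x1 * Xv) * (1 - x2 * Xv) * (1 - x1 * Yv) * (1 - x2 * Yv)) := by
  have hx : x2 - x1 ≠ 0 := by
    rw [sub_ne_zero]
    intro h
    have h' := IsFractionRing.injective P6 K h
    exact absurd (MvPolynomial.X_injective h') (by decide)
  have hy : y2 - y1 ≠ 0 := by
    rw [sub_ne_zero]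
    intro h
    have h' := IsFractionRing.injective P6 K h
    exact absurd (MvPolynomial.X_injective h') (by decide)
  unfold starMul G H
  rw [inv_mul_eq_iff_eq_mul₀ (mul_ne_zero hx hy)]
  simp only [div_eq_mul_inv, mul_inv]
  generalize (1 - x1 * Xv)⁻¹ = a
  generalize (1 - x2 * Xv)⁻¹ = b
  generalize (1 - x1 * Yv)⁻¹ = c
  generalize (1 - x2 * Yv)⁻¹ = d
  clear hx hy
  generalize x1 = p
  generalize x2 = q
  generalize y1 = r
  generalize y2 = s
  ring

end
end

section
/- In K one has g_0 ∗' g_0 = (y_1+y_2−x_1−x_2)·(x_1^2+x_2^2+2y_1y_2−(x_1+x_2)(y_1+y_2)) / ((1−x_1X)(1−x_2X)(1−x_1Y)(1−x_2Y)), where g_0(x) = 1/((1−xX)(1−xY)). -/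
/-!
`K` is the field of rational functions over ℚ in the six variables
`x₁, x₂, y₁, y₂, X, Y`, realized as the fraction field of
`MvPolynomial (Fin 6) ℚ`.  `starMul` is the Kontsevich–Soibelman shuffle
product of the Cohomological Hall algebra of the Kronecker quiver in
bidegree `(1,1) × (1,1)`, and `starMul'` the one in bidegree `(1,0) × (1,2)`
(evaluated on classes not depending on the `y`-variables of the second factor).
-/

open MvPolynomial

noncomputable section

theorem x2_sub_x1_ne : x2 - x1 ≠ 0 := by
  intro h
  have h2 : algebraMap P6 K (X 1) = algebraMap P6 K (X 0) := sub_eq_zero.mp h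
  have h3 := IsFractionRing.injective P6 K h2
  have h4 := MvPolynomial.X_injective h3
  exact absurd h4 (by decide)

theorem star_aux {F : Type*} [Field F] (a b c d p q r s : F) (h : b - a ≠ 0) :
    (b - a)⁻¹ * ((p * q)⁻¹ * (r * s)⁻¹ * (c - a) ^ 2 * (d - a) ^ 2 -
      (r * s)⁻¹ * (p * q)⁻¹ * (c - b) ^ 2 * (d - b) ^ 2) =
    (c + d - a - b) * (a ^ 2 + b ^ 2 + 2 * c * d - (a + b) * (c + d)) / (p * r * q * s) := by
  rw [inv_mul_eq_iff_eq_mul₀ h, div_eq_mul_inv]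
  simp only [mul_inv]
  ring

/-- `g₀ ∗′ g₀ = (y₁+y₂−x₁−x₂)(x₁²+x₂²+2y₁y₂−(x₁+x₂)(y₁+y₂))/(…)`. -/
theorem stmt14 : starMul' g0 g0
    = (y1 + y2 - x1 - x2) * (x1 ^ 2 + x2 ^ 2 + 2 * y1 * y2 - (x1 + x2) * (y1 + y2)) /
        ((1 - x1 * Xv) * (1 - x2 * Xv) * (1 - x1 * Yv) * (1 - x2 * Yv)) := by
  exact star_aux x1 x2 y1 y2 _ _ _ _ x2_sub_x1_ne

end
end
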